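/- Fidelity-susceptibility integral identity: for β > 0 and points x₀,...,x_q with 0 ≤ j < q, ∫₀^{β/2} τ · e^{−τ[x_{j+1},...,x_q]} · e^{−(β−τ)[x₀,...,x_j]} dτ = Σ_{r=0}^{j} e^{−(β/2)[x₀,...,x_r]} · Σ_{m=j+1}^{q} e^{−(β/2)[x_r,...,x_q,x_m]}. -/

import Mathlib

/-- Complete homogeneous symmetric polynomial of degree `m` evaluated on a list. -/
noncomputable def hSym (m : ℕ) (xs : List ℂ) : ℂ :=
  ∑ k ∈ Finset.Nat.antidiagonalTuple xs.length m, ∏ i : Fin xs.length, xs.get i ^ k i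

/-- Divided difference of an entire function over a list of points (multisets allowed),
via the series `f[x₀,...,x_q] = Σ_m f^{(q+m)}(0)/(q+m)! · h_m(x₀,...,x_q)`. -/
noncomputable def divDiff (f : ℂ → ℂ) (xs : List ℂ) : ℂ :=
  ∑' m : ℕ, iteratedDeriv (xs.length - 1 + m) f 0 /
    (Nat.factorial (xs.length - 1 + m) : ℂ) * hSym m xs

/-- Divided difference of the exponential `x ↦ exp (t * x)` over a list of points. -/
noncomputable def expDD (t : ℂ) (xs : List ℂ) : ℂ :=
  divDiff (fun z => Complex.exp (t * z)) xs

lemma hSym_nil_zero : hSym 0 [] = 1 := by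
  simp [hSym]

lemma hSym_nil_succ (m : ℕ) : hSym (m + 1) [] = 0 := by
  simp [hSym]

open Finset in
lemma hSym_cons (m : ℕ) (a : ℂ) (l : List ℂ) :
    hSym m (a :: l) = ∑ p ∈ antidiagonal m, a ^ p.1 * hSym p.2 l := by
  simp only [hSym, Finset.mul_sum]
  rw [Finset.sum_sigma']
  symm
  refine Finset.sum_bij'
    (i := fun p _ => (Fin.cons p.1.1 p.2 : Fin (l.length + 1) → ℕ))
    (j := fun k _ => ⟨(k 0, ∑ i : Fin l.length, k i.succ), fun i => k i.succ⟩) ?_ ?_ ?_ ?_ ?_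
  · rintro ⟨⟨i, n⟩, k⟩ h
    simp only [mem_sigma, HasAntidiagonal.mem_antidiagonal, Finset.Nat.mem_antidiagonalTuple] at h ⊢
    refine (Fin.sum_univ_succ (n := l.length) _).trans ?_
    simpa [h.2] using h.1
  · intro k h
    simp only [mem_sigma, HasAntidiagonal.mem_antidiagonal, Finset.Nat.mem_antidiagonalTuple] at h ⊢
    exact ⟨(Fin.sum_univ_succ (n := l.length) _).symm.trans h, trivial⟩
  · rintro ⟨⟨i, n⟩, k⟩ h
    simp only [mem_sigma, HasAntidiagonal.mem_antidiagonal, Finset.Nat.mem_antidiagonalTuple] at h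
    obtain ⟨-, rfl⟩ := h
    simp
  · intro k h
    exact Fin.cons_self_tail (n := l.length) (α := fun _ => ℕ) k
  · rintro ⟨⟨i, n⟩, k⟩ h
    refine Eq.trans ?_ (Fin.prod_univ_succ (n := l.length) _).symm
    simp

lemma hSym_zero (l : List ℂ) : hSym 0 l = 1 := by
  induction l with
  | nil => exact hSym_nil_zero
  | cons a l ih => simp [hSym_cons, ih]

lemma hSym_succ_cons (m : ℕ) (a : ℂ) (l : List ℂ) :
    hSym (m + 1) (a :: l) = a * hSym m (a :: l) + hSym (m + 1) l := by
  rw [hSym_cons, hSym_cons, Finset.Nat.antidiagonal_succ, Finset.sum_cons, Finset.sum_map,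
    Finset.mul_sum, add_comm]
  simp [pow_succ', mul_assoc]

lemma hSym_singleton (m : ℕ) (a : ℂ) : hSym m [a] = a ^ m := by
  induction m with
  | zero => simp [hSym_zero]
  | succ m ih => rw [hSym_succ_cons, ih, hSym_nil_succ, pow_succ']; ring

lemma hSym_swap (m : ℕ) (a b : ℂ) (l : List ℂ) : hSym m (a :: b :: l) = hSym m (b :: a :: l) := by
  induction m using Nat.strong_induction_on with
  | _ m ih =>
    match m with
    | 0 => simp [hSym_zero]
    | 1 => simp only [hSym_succ_cons, hSym_zero]; ring
    | m + 2 =>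
      have h := ih (m + 1) (by omega)
      have h0 := ih m (by omega)
      simp only [hSym_succ_cons] at h ⊢
      rw [h0]
      rw [h0] at h
      linear_combination (a + b) * h

lemma hSym_perm {l l' : List ℂ} (h : l.Perm l') (m : ℕ) : hSym m l = hSym m l' := by
  induction h generalizing m with
  | nil => rfl
  | cons a _ ih => simp only [hSym_cons, ih]
  | swap a b l => exact hSym_swap m b a l
  | trans _ _ ih₁ ih₂ => rw [ih₁, ih₂]

lemma norm_hSym_le (m : ℕ) (l : List ℂ) : ‖hSym m l‖ ≤ (l.map (‖·‖)).sum ^ m := by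
  induction l generalizing m with
  | nil =>
    cases m with
    | zero => simp [hSym_zero]
    | succ m => simp [hSym_nil_succ]
  | cons a l ih =>
    have hS : 0 ≤ (l.map (‖·‖)).sum := List.sum_nonneg (by simp)
    induction m with
    | zero => simp [hSym_zero]
    | succ m ihm =>
      rw [hSym_succ_cons, List.map_cons, List.sum_cons] at *
      set S := (l.map (‖·‖)).sum
      calc ‖a * hSym m (a :: l) + hSym (m + 1) l‖
          ≤ ‖a‖ * ‖hSym m (a :: l)‖ + ‖hSym (m + 1) l‖ := by
            simpa using norm_add_le (a * hSym m (a :: l)) (hSym (m + 1) l)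
        _ ≤ ‖a‖ * (‖a‖ + S) ^ m + S ^ m * S := by
            gcongr
            exact pow_succ S m ▸ ih (m + 1)
        _ ≤ ‖a‖ * (‖a‖ + S) ^ m + (‖a‖ + S) ^ m * S := by
            gcongr
            linarith [norm_nonneg a]
        _ = (‖a‖ + S) ^ (m + 1) := by ring

lemma summable_pow_div_factorial_mul {c : ℕ → ℂ} {S : ℝ} (hc : ∀ k, ‖c k‖ ≤ S ^ k) (t : ℂ) :
    Summable fun k : ℕ => t ^ k / (k.factorial : ℂ) * c k := by
  refine .of_norm_bounded (Real.summable_pow_div_factorial (‖t‖ * S)) fun k => ?_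
  calc ‖t ^ k / (k.factorial : ℂ) * c k‖ = ‖t‖ ^ k / k.factorial * ‖c k‖ := by simp
    _ ≤ ‖t‖ ^ k / k.factorial * S ^ k := by gcongr; exact hc k
    _ = _ := by ring

lemma hasDerivAt_tsum_pow_div_factorial_mul {c : ℕ → ℂ} {S : ℝ} (hc : ∀ k, ‖c k‖ ≤ S ^ k)
    (t : ℂ) :
    HasDerivAt (fun z : ℂ => ∑' k : ℕ, z ^ k / (k.factorial : ℂ) * c k)
      (∑' k : ℕ, t ^ k / (k.factorial : ℂ) * c (k + 1)) t := by
  have hS : 0 ≤ S := by simpa using (norm_nonneg _).trans (hc 1)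
  set R := ‖t‖ + 1
  have hR : 0 ≤ R := by positivity
  have hsplit : (fun z : ℂ => ∑' k : ℕ, z ^ k / (k.factorial : ℂ) * c k) =
      fun z => c 0 + ∑' k : ℕ, z ^ (k + 1) / ((k + 1).factorial : ℂ) * c (k + 1) := by
    funext z
    rw [(summable_pow_div_factorial_mul hc z).tsum_eq_zero_add]
    simp
  rw [hsplit]
  have hderiv (k : ℕ) (z : ℂ) :
      HasDerivAt (fun z : ℂ => z ^ (k + 1) / ((k + 1).factorial : ℂ) * c (k + 1))
        (z ^ k / (k.factorial : ℂ) * c (k + 1)) z := by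
    refine (((hasDerivAt_pow (k + 1) z).div_const _).mul_const _).congr_deriv ?_
    have : (k.factorial : ℂ) ≠ 0 := by exact_mod_cast k.factorial_ne_zero
    have : (k : ℂ) + 1 ≠ 0 := by exact_mod_cast k.succ_ne_zero
    rw [Nat.factorial_succ, Nat.add_sub_cancel]
    push_cast
    field_simp
  have hbound (k : ℕ) (z : ℂ) (hz : z ∈ Metric.ball 0 R) :
      ‖z ^ k / (k.factorial : ℂ) * c (k + 1)‖ ≤ (R * S) ^ k / k.factorial * S := by
    have hz : ‖z‖ ≤ R := by simpa using (Metric.mem_ball.mp hz).le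
    calc ‖z ^ k / (k.factorial : ℂ) * c (k + 1)‖ = ‖z‖ ^ k / k.factorial * ‖c (k + 1)‖ := by simp
      _ ≤ R ^ k / k.factorial * S ^ (k + 1) := by gcongr; exact hc _
      _ = _ := by rw [mul_pow, pow_succ]; ring
  have ht : t ∈ Metric.ball 0 R := by simp [R]
  have hsum : Summable fun k : ℕ => t ^ (k + 1) / ((k + 1).factorial : ℂ) * c (k + 1) :=
    (summable_nat_add_iff 1).mpr (summable_pow_div_factorial_mul hc t)
  exact (hasDerivAt_tsum_of_isPreconnected
    ((Real.summable_pow_div_factorial (R * S)).mul_right S) Metric.isOpen_ball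
    (convex_ball 0 R).isPreconnected (fun k z _ => hderiv k z) hbound ht hsum ht).const_add _

/-- The coefficient of `t ^ k / k!` in the expansion of `expDD t l`: the divided difference of
`x ↦ x ^ k` over `l`. -/
noncomputable def powDD (k : ℕ) (l : List ℂ) : ℂ :=
  if k + 1 < l.length then 0 else hSym (k + 1 - l.length) l

lemma powDD_singleton (k : ℕ) (a : ℂ) : powDD k [a] = a ^ k := by
  simp [powDD, hSym_singleton]

lemma powDD_succ_cons (k : ℕ) (a : ℂ) {l : List ℂ} (hl : l ≠ []) :
    powDD (k + 1) (a :: l) = a * powDD k (a :: l) + powDD k l := by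
  have hpos := List.length_pos_of_ne_nil hl
  simp only [powDD, List.length_cons]
  rcases lt_trichotomy (k + 1) l.length with h | h | h
  · simp [h, show k < l.length by omega]
  · simp [← h, hSym_zero]
  · rw [if_neg (by omega), if_neg (by omega), if_neg (by omega),
      show k + 1 + 1 - (l.length + 1) = k - l.length + 1 by omega, hSym_succ_cons]
    congr 3 <;> omega

lemma norm_powDD_le (k : ℕ) {l : List ℂ} (hl : l ≠ []) :
    ‖powDD k l‖ ≤ (1 + (l.map (‖·‖)).sum) ^ k := by
  have hpos := List.length_pos_of_ne_nil hl
  have hS : 0 ≤ (l.map (‖·‖)).sum := List.sum_nonneg (by simp)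
  unfold powDD
  split_ifs
  · simpa using by positivity
  · refine (norm_hSym_le _ _).trans ?_
    calc _ ≤ (1 + (l.map (‖·‖)).sum) ^ (k + 1 - l.length) := by gcongr; linarith
      _ ≤ _ := pow_le_pow_right₀ (by linarith) (by omega)

lemma expDD_eq_tsum_powDD (t : ℂ) {l : List ℂ} (hl : l ≠ []) :
    expDD t l = ∑' k : ℕ, t ^ k / (k.factorial : ℂ) * powDD k l := by
  have hpos := List.length_pos_of_ne_nil hl
  have hinj : Function.Injective fun m : ℕ => l.length - 1 + m := add_right_injective _
  rw [← hinj.tsum_eq]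
  · unfold expDD divDiff
    refine tsum_congr fun m => ?_
    rw [iteratedDeriv_cexp_const_mul, powDD, if_neg (by omega),
      show l.length - 1 + m + 1 - l.length = m by omega]
    simp
  · intro k hk
    by_contra hne
    refine hk ?_
    have : k + 1 < l.length := by
      by_contra h
      exact hne ⟨k + 1 - l.length, by simp only; omega⟩
    simp [powDD, this]

lemma expDD_singleton (t a : ℂ) : expDD t [a] = Complex.exp (a * t) := by
  rw [expDD_eq_tsum_powDD t (by simp), Complex.exp_eq_exp_ℂ, NormedSpace.exp_eq_tsum_div]
  refine tsum_congr fun k => ?_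
  rw [powDD_singleton, mul_pow]
  ring

lemma expDD_perm {l l' : List ℂ} (h : l.Perm l') (t : ℂ) : expDD t l = expDD t l' := by
  simp only [expDD, divDiff, h.length_eq, hSym_perm h]

lemma expDD_zero {l : List ℂ} (hl : l ≠ []) : expDD 0 l = if l.length = 1 then 1 else 0 := by
  have hpos := List.length_pos_of_ne_nil hl
  rw [expDD_eq_tsum_powDD 0 hl, tsum_eq_single 0 (by intro k hk; simp [hk]), powDD]
  split_ifs <;> first | omega | simp_all [hSym_zero]

lemma expDD_zero_cons (a : ℂ) {l : List ℂ} (hl : l ≠ []) : expDD 0 (a :: l) = 0 := by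
  rw [expDD_zero (by simp), if_neg (by simpa using hl)]

lemma hasDerivAt_expDD_cons (a : ℂ) {l : List ℂ} (hl : l ≠ []) (t : ℂ) :
    HasDerivAt (fun z => expDD z (a :: l)) (a * expDD t (a :: l) + expDD t l) t := by
  have hal : a :: l ≠ [] := by simp
  simp only [expDD_eq_tsum_powDD _ hal, expDD_eq_tsum_powDD _ hl]
  have hs := summable_pow_div_factorial_mul (fun k => norm_powDD_le k hal) t
  have hs' := summable_pow_div_factorial_mul (fun k => norm_powDD_le k hl) t
  convert hasDerivAt_tsum_pow_div_factorial_mul (fun k => norm_powDD_le k hal) t using 1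
  rw [← tsum_mul_left, ← (hs.mul_left a).tsum_add hs']
  refine tsum_congr fun k => ?_
  rw [powDD_succ_cons k a hl]
  ring

lemma hasDerivAt_expDD_singleton (a t : ℂ) :
    HasDerivAt (fun z => expDD z [a]) (a * expDD t [a]) t := by
  simp only [expDD_singleton]
  simpa [mul_comm] using ((hasDerivAt_id t).const_mul a).cexp

lemma differentiable_expDD {l : List ℂ} (hl : l ≠ []) : Differentiable ℂ fun z => expDD z l := by
  match l with
  | [a] => exact fun t => (hasDerivAt_expDD_singleton a t).differentiableAt
  | a :: b :: l =>
    exact fun t => (hasDerivAt_expDD_cons a (l := b :: l) (by simp) t).differentiableAt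

/-- Uniqueness for the linear equation `f' = a f + r`. -/
lemma eq_of_hasDerivAt_linear {f g r : ℂ → ℂ} {a : ℂ}
    (hf : ∀ t, HasDerivAt f (a * f t + r t) t) (hg : ∀ t, HasDerivAt g (a * g t + r t) t)
    (h₀ : f 0 = g 0) (t : ℂ) : f t = g t := by
  have hd (z : ℂ) : HasDerivAt (fun z => (f z - g z) * Complex.exp (-a * z)) 0 z := by
    have h := ((hf z).sub (hg z)).mul (((hasDerivAt_id z).const_mul (-a)).cexp)
    refine h.congr_deriv ?_
    simp only [Pi.sub_apply, id]
    ring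
  have h := is_const_of_deriv_eq_zero (fun z => (hd z).differentiableAt) (fun z => (hd z).deriv) t 0
  simpa [h₀, sub_eq_zero] using h

/-- Leibniz rule for the product `exp (s * x) * exp (t * x)`. -/
lemma expDD_add (s t : ℂ) {l : List ℂ} (hl : l ≠ []) :
    expDD (s + t) l =
      ∑ r ∈ Finset.range l.length, expDD s (l.take (r + 1)) * expDD t (l.drop r) := by
  induction l generalizing s with
  | nil => contradiction
  | cons a l ih =>
    rcases eq_or_ne l [] with rfl | hne
    · simp [expDD_singleton, mul_add, Complex.exp_add]
    refine eq_of_hasDerivAt_linear (f := fun s => expDD (s + t) (a :: l))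
      (g := fun s => ∑ r ∈ Finset.range (a :: l).length,
        expDD s ((a :: l).take (r + 1)) * expDD t ((a :: l).drop r))
      (r := fun s => expDD (s + t) l) (a := a) ?_ ?_ ?_ s
    · intro s
      exact (hasDerivAt_expDD_cons a hne (s + t)).comp_add_const s t
    · intro s
      simp only [List.length_cons, Finset.sum_range_succ', List.take_succ_cons, List.drop_succ_cons,
        List.take_zero, List.drop_zero]
      have h₁ (r : ℕ) : HasDerivAt (fun s => expDD s (a :: l.take (r + 1)) * expDD t (l.drop r))
          ((a * expDD s (a :: l.take (r + 1)) + expDD s (l.take (r + 1))) * expDD t (l.drop r))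
          s :=
        (hasDerivAt_expDD_cons a (by simpa using hne) s).mul_const _
      have h := (HasDerivAt.fun_sum fun r (_ : r ∈ Finset.range l.length) => h₁ r).add
        ((hasDerivAt_expDD_singleton a s).mul_const (expDD t (a :: l)))
      refine h.congr_deriv ?_
      rw [ih s hne]
      simp only [add_mul, Finset.sum_add_distrib, mul_add, Finset.mul_sum, mul_assoc]
      ring
    · simp only [List.length_cons, Finset.sum_range_succ', List.take_succ_cons,
        List.drop_succ_cons, List.take_zero, List.drop_zero]
      rw [Finset.sum_eq_zero fun r _ => by
        rw [expDD_zero_cons a (by simpa using hne), zero_mul]]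
      simp [expDD_singleton]

lemma mul_expDD (t : ℂ) {l : List ℂ} (hl : l ≠ []) :
    t * expDD t l = (l.map fun m => expDD t (m :: l)).sum := by
  induction l generalizing t with
  | nil => contradiction
  | cons a l ih =>
    have hder (m s : ℂ) : HasDerivAt (fun z => expDD z (m :: a :: l))
        (a * expDD s (m :: a :: l) + expDD s (m :: l)) s := by
      have h := hasDerivAt_expDD_cons a (l := m :: l) (by simp) s
      simpa only [expDD_perm (List.Perm.swap m a l)] using h
    have hsum (l' : List ℂ) (s : ℂ) :
        HasDerivAt (fun z => (l'.map fun m => expDD z (m :: a :: l)).sum)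
          (a * (l'.map fun m => expDD s (m :: a :: l)).sum +
            (l'.map fun m => expDD s (m :: l)).sum) s := by
      induction l' with
      | nil => simpa using hasDerivAt_const s (0 : ℂ)
      | cons m l' ihl =>
        simp only [List.map_cons, List.sum_cons]
        exact ((hder m s).add ihl).congr_deriv (by ring)
    refine eq_of_hasDerivAt_linear (f := fun t => t * expDD t (a :: l))
      (r := fun t => ((a :: l).map fun m => expDD t (m :: l)).sum) (a := a) ?_ (hsum (a :: l)) ?_ t
    · intro s
      rcases eq_or_ne l [] with rfl | hne
      · refine ((hasDerivAt_id s).mul (hasDerivAt_expDD_singleton a s)).congr_deriv ?_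
        simp
        ring
      · refine ((hasDerivAt_id s).mul (hasDerivAt_expDD_cons a hne s)).congr_deriv ?_
        simp only [List.map_cons, List.sum_cons, ← ih s hne, id]
        ring
    · simp only [zero_mul]
      refine (List.sum_eq_zero ?_).symm
      simp only [List.mem_map]
      rintro _ ⟨m, -, rfl⟩
      exact expDD_zero_cons m (by simp)

lemma hasDerivAt_comp_neg_ofReal {f : ℂ → ℂ} {f' : ℂ} {τ : ℝ} (h : HasDerivAt f f' (-(τ : ℂ))) :
    HasDerivAt (fun τ : ℝ => f (-(τ : ℂ))) (-f') τ := by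
  have h₂ : HasDerivAt (fun z : ℂ => -z) (-1) (τ : ℂ) := (hasDerivAt_id _).neg
  simpa using (HasDerivAt.comp (τ : ℂ) h h₂).comp_ofReal

lemma hasDerivAt_comp_neg_sub_ofReal {f : ℂ → ℂ} {f' b : ℂ} {τ : ℝ}
    (h : HasDerivAt f f' (-(b - (τ : ℂ)))) :
    HasDerivAt (fun τ : ℝ => f (-(b - (τ : ℂ)))) f' τ := by
  have h₂ : HasDerivAt (fun z : ℂ => -(b - z)) 1 (τ : ℂ) := by
    exact ((hasDerivAt_id (τ : ℂ)).const_sub b).neg.congr_deriv (neg_neg 1)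
  simpa using (HasDerivAt.comp (τ : ℂ) h h₂).comp_ofReal

lemma continuous_expDD_mul_expDD (b : ℂ) {xs ys : List ℂ} (hxs : xs ≠ []) (hys : ys ≠ []) :
    Continuous fun τ : ℝ => expDD (-(τ : ℂ)) ys * expDD (-(b - (τ : ℂ))) xs := by
  have h₁ := (differentiable_expDD hxs).continuous
  have h₂ := (differentiable_expDD hys).continuous
  exact (h₂.comp (by fun_prop : Continuous fun τ : ℝ => -(τ : ℂ))).mul
    (h₁.comp (by fun_prop : Continuous fun τ : ℝ => -(b - (τ : ℂ))))

/-- The convolution of two divided differences of the exponential. -/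
lemma integral_expDD_mul_expDD (b : ℝ) {xs ys : List ℂ} (hxs : xs ≠ []) (hys : ys ≠ []) :
    ∫ τ in (0 : ℝ)..b, expDD (-(τ : ℂ)) ys * expDD (-((b : ℂ) - (τ : ℂ))) xs =
      -expDD (-(b : ℂ)) (xs ++ ys) := by
  induction xs generalizing ys with
  | nil => contradiction
  | cons a l ih =>
    have hy (τ : ℝ) := hasDerivAt_comp_neg_ofReal (hasDerivAt_expDD_cons a hys (-(τ : ℂ)))
    have hint := (continuous_expDD_mul_expDD b hxs hys).intervalIntegrable
      (μ := MeasureTheory.volume) 0 b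
    rcases eq_or_ne l [] with rfl | hne
    · have hd (τ : ℝ) := (hy τ).mul (hasDerivAt_comp_neg_sub_ofReal (b := b)
        (hasDerivAt_expDD_singleton a (-((b : ℂ) - (τ : ℂ)))))
      have h := intervalIntegral.integral_eq_sub_of_hasDerivAt (a := 0) (b := b)
        (f' := fun τ : ℝ => -(expDD (-(τ : ℂ)) ys * expDD (-((b : ℂ) - (τ : ℂ))) [a]))
        (fun τ _ => (hd τ).congr_deriv (by ring)) hint.neg
      rw [intervalIntegral.integral_neg] at h
      rw [← neg_inj, h]
      simp [expDD_zero_cons a hys, expDD_singleton]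
    · have hint' := (continuous_expDD_mul_expDD b hne (ys := a :: ys) (by simp)).intervalIntegrable
        (μ := MeasureTheory.volume) 0 b
      have hd (τ : ℝ) := (hy τ).mul (hasDerivAt_comp_neg_sub_ofReal (b := b)
        (hasDerivAt_expDD_cons a hne (-((b : ℂ) - (τ : ℂ)))))
      have h := intervalIntegral.integral_eq_sub_of_hasDerivAt (a := 0) (b := b)
        (f' := fun τ : ℝ => expDD (-(τ : ℂ)) (a :: ys) * expDD (-((b : ℂ) - (τ : ℂ))) l -
          expDD (-(τ : ℂ)) ys * expDD (-((b : ℂ) - (τ : ℂ))) (a :: l))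
        (fun τ _ => (hd τ).congr_deriv (by ring)) (hint'.sub hint)
      rw [intervalIntegral.integral_sub hint' hint, ih hne (by simp)] at h
      simp only [Pi.mul_apply, sub_self, Complex.ofReal_zero, neg_zero, expDD_zero_cons a hys,
        expDD_zero_cons a hne, mul_zero, zero_mul] at h
      rw [← sub_eq_zero.mp h, expDD_perm List.perm_middle]
      rfl

/-- The integral identity for lists of points. -/
lemma integral_mul_expDD_mul_expDD (β : ℝ) {xs ys : List ℂ} (hxs : xs ≠ []) (hys : ys ≠ []) :
    ∫ τ in (0 : ℝ)..(β / 2),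
        (τ : ℂ) * expDD (-(τ : ℂ)) ys * expDD (-((β : ℂ) - (τ : ℂ))) xs =
      ∑ r ∈ Finset.range xs.length, expDD (-((β / 2 : ℝ) : ℂ)) (xs.take (r + 1)) *
        (ys.map fun m => expDD (-((β / 2 : ℝ) : ℂ)) (xs.drop r ++ ys ++ [m])).sum := by
  set b : ℝ := β / 2 with hb
  have hintegrand (τ : ℝ) : (τ : ℂ) * expDD (-(τ : ℂ)) ys * expDD (-((β : ℂ) - (τ : ℂ))) xs =
      ∑ r ∈ Finset.range xs.length, ∑ i : Fin ys.length, -expDD (-(b : ℂ)) (xs.take (r + 1)) *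
        (expDD (-(τ : ℂ)) (ys.get i :: ys) * expDD (-((b : ℂ) - (τ : ℂ))) (xs.drop r)) := by
    have h₁ : (τ : ℂ) * expDD (-(τ : ℂ)) ys =
        -∑ i : Fin ys.length, expDD (-(τ : ℂ)) (ys.get i :: ys) := by
      rw [← List.sum_ofFn, ← neg_eq_iff_eq_neg, ← neg_mul, mul_expDD _ hys]
      congr 1
      conv_lhs => rw [← List.ofFn_get ys, List.map_ofFn]
      rw [List.ofFn_get]
      rfl
    have h₂ : -((β : ℂ) - (τ : ℂ)) = -(b : ℂ) + -((b : ℂ) - (τ : ℂ)) := by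
      rw [hb]; push_cast; ring
    rw [h₁, h₂, expDD_add _ _ hxs, Finset.mul_sum]
    refine Finset.sum_congr rfl fun r _ => ?_
    rw [neg_mul, Finset.sum_mul, ← Finset.sum_neg_distrib]
    exact Finset.sum_congr rfl fun i _ => by ring
  have hdrop {r : ℕ} (hr : r ∈ Finset.range xs.length) : xs.drop r ≠ [] := by
    simpa using hr
  have hii (r : ℕ) (hr : r ∈ Finset.range xs.length) (i : Fin ys.length) :=
    (((continuous_expDD_mul_expDD b (hdrop hr) (ys := ys.get i :: ys)
      (by simp)).const_mul (-expDD (-(b : ℂ)) (xs.take (r + 1)))).intervalIntegrable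
      (μ := MeasureTheory.volume) 0 b)
  simp only [hintegrand]
  rw [intervalIntegral.integral_finsetSum]
  swap
  · intro r hr
    convert! IntervalIntegrable.sum Finset.univ fun i _ => hii r hr i using 1
    funext τ
    simp only [Finset.sum_apply]
  refine Finset.sum_congr rfl fun r hr => ?_
  rw [intervalIntegral.integral_finsetSum fun i _ => hii r hr i]
  simp only [intervalIntegral.integral_const_mul]
  simp only [integral_expDD_mul_expDD b (hdrop hr) (List.cons_ne_nil _ ys)]
  rw [← Finset.mul_sum, Finset.sum_neg_distrib, neg_mul_neg, ← List.sum_ofFn]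
  congr 2
  conv_rhs => rw [← List.ofFn_get ys, List.map_ofFn]
  rw [List.ofFn_get]
  congr 1
  funext i
  refine expDD_perm ?_ _
  rw [List.append_assoc]
  exact (List.perm_append_left_iff _).2 (List.perm_append_singleton _ _).symm

/-- Fidelity-susceptibility integral identity:
`∫₀^{β/2} τ e^{−τ[x_{j+1},...,x_q]} e^{−(β−τ)[x₀,...,x_j]} dτ
  = Σ_{r=0}^{j} e^{−(β/2)[x₀,...,x_r]} Σ_{m=j+1}^{q} e^{−(β/2)[x_r,...,x_q,x_m]}`. -/
theorem expDD_fs_integral (β : ℝ) (hβ : 0 < β) (q j : ℕ) (hj : j < q)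
    (x : Fin (q + 1) → ℂ) :
    ∫ τ in (0:ℝ)..(β / 2),
        (τ : ℂ) *
          expDD (-(τ : ℂ)) (List.ofFn fun i : Fin (q - j) =>
            x ⟨j + 1 + i.val, by have := i.isLt; omega⟩) *
          expDD (-((β : ℂ) - (τ : ℂ))) (List.ofFn fun i : Fin (j + 1) =>
            x ⟨i.val, by have := i.isLt; omega⟩)
      = ∑ r : Fin (j + 1),
          expDD (-((β / 2 : ℝ) : ℂ)) (List.ofFn fun i : Fin (r.val + 1) =>
            x ⟨i.val, by have := i.isLt; have := r.isLt; omega⟩) *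
          ∑ m : Fin (q - j),
            expDD (-((β / 2 : ℝ) : ℂ))
              ((List.ofFn fun i : Fin (q + 1 - r.val) =>
                  x ⟨r.val + i.val, by have := i.isLt; omega⟩) ++
                [x ⟨j + 1 + m.val, by have := m.isLt; omega⟩]) := by
  set xs : List ℂ := List.ofFn fun i : Fin (j + 1) => x ⟨i.val, by have := i.isLt; omega⟩ with hxs
  set ys : List ℂ := List.ofFn fun i : Fin (q - j) =>
    x ⟨j + 1 + i.val, by have := i.isLt; omega⟩ with hys
  have hxl : xs.length = j + 1 := by simp [hxs]
  have hyl : ys.length = q - j := by simp [hys]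
  rw [integral_mul_expDD_mul_expDD β (List.ne_nil_of_length_pos (by omega))
    (List.ne_nil_of_length_pos (by omega)), hxl, Finset.sum_range]
  refine Finset.sum_congr rfl fun r _ => ?_
  have htake : xs.take (r.val + 1) = List.ofFn fun i : Fin (r.val + 1) =>
      x ⟨i.val, by have := i.isLt; have := r.isLt; omega⟩ := by
    refine List.ext_getElem (by simp [hxl]; omega) fun i h₁ h₂ => ?_
    simp only [hxs, List.getElem_take, List.getElem_ofFn]
  have hdrop : xs.drop r.val ++ ys = List.ofFn fun i : Fin (q + 1 - r.val) =>
      x ⟨r.val + i.val, by have := i.isLt; omega⟩ := by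
    refine List.ext_getElem (by simp [hxl, hyl]; omega) fun i h₁ h₂ => ?_
    rw [List.getElem_append]
    split_ifs with h
    · simp only [hxs, List.getElem_drop, List.getElem_ofFn]
    · simp only [hys, List.getElem_ofFn, List.length_drop, hxl] at h ⊢
      congr 2
      omega
  rw [htake, hdrop, ← List.sum_ofFn, hys, List.map_ofFn]
  rfl
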